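/- For every Laurent polynomial p ∈ ℂ[x,x⁻¹]: k·A(dp/dx) = w^{k−1}·∂(A p)/∂x + w^{k+1}·∂(A p)/∂w in L((w)). (This is equation (2.7) of the paper, −Δ_k^x(z)(∂/∂x) + (1/k) z^{1/k−1} (∂/∂x) Δ_k^x(z) = (∂/∂z) Δ_k^x(z), rewritten in the variable w = z^{−1/k}.) -/

import Mathlib

/-!
STATEMENT 5.  Equation (2.7) of the paper, rewritten in the variable `w = z^{−1/k}`:
for every Laurent polynomial `p ∈ ℂ[x,x⁻¹]`,
`k·A(dp/dx) = w^{k−1}·∂(A p)/∂x + w^{k+1}·∂(A p)/∂w`  in `L((w))`,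
where `L = ℂ[x,x⁻¹]`, `L((w))` is the Laurent-series ring `LaurentSeries L`,
`a = w^{−k}((1+wx)^k − 1) = Σ_{l=1}^{k} C(k,l) x^l w^{l−k}`, and `A : L → L((w))` is the
(unique) `ℂ`-algebra homomorphism with `A(x) = a` (here taken as a hypothesis; `x` is
`LaurentPolynomial.T 1`).  The operator `∂/∂x` acts coefficientwise through the derivative
`d/dx` of Laurent polynomials (the unique `ℂ`-linear map `Dx` with `Dx(xⁿ) = n xⁿ⁻¹`),
and `∂/∂w` is the formal derivative in `w`.
-/

open LaurentPolynomial

/-- `a = w^{−k}((1+wx)^k − 1) = Σ_{l=1}^{k} C(k,l) x^l w^{l−k} ∈ L((w))`. -/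
noncomputable def aSeries (k : ℕ) : LaurentSeries (LaurentPolynomial ℂ) :=
  ∑ l ∈ Finset.Icc 1 k,
    HahnSeries.single ((l : ℤ) - (k : ℤ)) ((k.choose l : ℂ) • LaurentPolynomial.T (l : ℤ))

/-- `∂/∂x` on `L((w))`: apply the derivative `Dx` of `L = ℂ[x,x⁻¹]` to each coefficient. -/
noncomputable def derivX (Dx : LaurentPolynomial ℂ →ₗ[ℂ] LaurentPolynomial ℂ)
    (F : LaurentSeries (LaurentPolynomial ℂ)) : LaurentSeries (LaurentPolynomial ℂ) where
  coeff m := Dx (F.coeff m)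
  isPWO_support' := F.isPWO_support'.mono (by
    intro m hm
    simp only [Function.mem_support] at hm ⊢
    intro h0
    exact hm (by rw [h0, map_zero]))

/-- `∂/∂w` on `L((w))`: the formal derivative in the variable `w`. -/
noncomputable def derivW (F : LaurentSeries (LaurentPolynomial ℂ)) :
    LaurentSeries (LaurentPolynomial ℂ) where
  coeff m := (m + 1) • F.coeff (m + 1)
  isPWO_support' := by
    refine (F.isPWO_support'.image_of_monotone
      (f := fun m : ℤ => m - 1) (fun x y h => by dsimp only; omega)).mono ?_
    intro m hm
    simp only [Function.mem_support] at hm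
    refine ⟨m + 1, ?_, by dsimp only; omega⟩
    simp only [Function.mem_support]
    intro h0
    exact hm (by rw [h0, smul_zero])

namespace HahnSeries

/-- The operator on Hahn series applying the additive map `φ g` to the coefficient in degree `g`. -/
def coeffwise {Γ R : Type*} [PartialOrder Γ] [AddCommMonoid R] (φ : Γ → R →+ R) :
    HahnSeries Γ R →+ HahnSeries Γ R where
  toFun F :=
    { coeff := fun g => φ g (F.coeff g)
      isPWO_support' := F.isPWO_support'.mono fun g hg h0 => hg (by
        change F.coeff g = 0 at h0
        change φ g (F.coeff g) = 0
        rw [h0, map_zero]) }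
  map_zero' := by ext; simp
  map_add' F G := by ext; simp

@[simp]
theorem coeff_coeffwise {Γ R : Type*} [PartialOrder Γ] [AddCommMonoid R] (φ : Γ → R →+ R)
    (F : HahnSeries Γ R) (g : Γ) : (coeffwise φ F).coeff g = φ g (F.coeff g) :=
  rfl

theorem coeffwise_single {Γ R : Type*} [PartialOrder Γ] [AddCommMonoid R] (φ : Γ → R →+ R)
    (g : Γ) (r : R) : coeffwise φ (single g r) = single g (φ g r) := by
  ext h
  by_cases hg : h = g
  · subst hg; simp
  · simp [coeff_single_of_ne hg]

theorem support_coeffwise_subset {Γ R : Type*} [PartialOrder Γ] [AddCommMonoid R]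
    (φ : Γ → R →+ R) (F : HahnSeries Γ R) : (coeffwise φ F).support ⊆ F.support := by
  intro g hg h0
  exact hg (by rw [coeff_coeffwise, h0, map_zero])

/-- A graded Leibniz rule for the maps `φ g` makes `coeffwise φ` satisfy the Leibniz rule. -/
theorem coeffwise_mul {Γ R : Type*} [AddCommMonoid Γ] [PartialOrder Γ] [IsOrderedCancelAddMonoid Γ]
    [CommSemiring R] (φ : Γ → R →+ R)
    (hφ : ∀ g h a b, φ (g + h) (a * b) = a * φ h b + b * φ g a) (F G : HahnSeries Γ R) :
    coeffwise φ (F * G) = F * coeffwise φ G + G * coeffwise φ F := by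
  ext g
  rw [mul_comm G, coeff_add, coeff_coeffwise, coeff_mul, map_sum,
    coeff_mul_right' G.isPWO_support (support_coeffwise_subset φ G),
    coeff_mul_left' F.isPWO_support (support_coeffwise_subset φ F), ← Finset.sum_add_distrib]
  refine Finset.sum_congr rfl fun ij hij => ?_
  rw [← (Finset.mem_antidiagonal.mp hij).2.2, hφ, coeff_coeffwise, coeff_coeffwise,
    mul_comm (G.coeff _)]

end HahnSeries

/-- A linear map with `T n ↦ n • T (n - 1)` satisfies the Leibniz rule. -/
theorem LaurentPolynomial.leibniz_of_map_T {R : Type*} [CommRing R] (D : R[T;T⁻¹] →ₗ[R] R[T;T⁻¹])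
    (hD : ∀ n : ℤ, D (T n) = n • T (n - 1)) (a b : R[T;T⁻¹]) :
    D (a * b) = a * D b + b * D a := by
  induction a using LaurentPolynomial.induction_on' with
  | add p q hp hq => rw [add_mul, map_add, hp, hq, map_add]; ring
  | C_mul_T m r =>
    induction b using LaurentPolynomial.induction_on' with
    | add p q hp hq => rw [mul_add, map_add, hp, hq, map_add]; ring
    | C_mul_T n s =>
      rw [← smul_eq_C_mul, ← smul_eq_C_mul, smul_mul_smul_comm, ← T_add, map_smul, map_smul,
        map_smul, hD, hD, hD, smul_mul_smul_comm, smul_mul_smul_comm, mul_smul_comm,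
        mul_smul_comm, ← T_add, ← T_add, mul_comm s r, ← smul_add, add_smul,
        show m + (n - 1) = m + n - 1 by ring, show n + (m - 1) = m + n - 1 by ring, add_comm]

/-- A derivation composed with a ring homomorphism on Laurent polynomials is determined on the
powers of the variable by its value at `T 1`. -/
theorem map_ringHom_T_of_leibniz {R B : Type*} [CommRing R] [CommRing B] (D : B →+ B)
    (hD : ∀ F G, D (F * G) = F * D G + G * D F) (A : R[T;T⁻¹] →+* B) (n : ℤ) :
    D (A (T n)) = n • (A (T (n - 1)) * D (A (T 1))) := by
  have inv (m : ℤ) : A (T m) * A (T (-m)) = 1 := by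
    rw [← map_mul, ← T_add, add_neg_cancel, T_zero, map_one]
  let φ : ℤ →+ B := AddMonoidHom.mk' (fun m => A (T (-m)) * D (A (T m))) fun m m' => by
    have h1 := inv m
    have h2 := inv m'
    simp only [neg_add, T_add, map_mul, hD]
    linear_combination (A (T (-m')) * D (A (T m'))) * h1 + (A (T (-m)) * D (A (T m))) * h2
  have h : φ n = n • φ 1 := by rw [← map_zsmul, smul_eq_mul, mul_one]
  change A (T (-n)) * D (A (T n)) = n • (A (T (-1)) * D (A (T 1))) at h
  rw [sub_eq_add_neg, T_add, map_mul, mul_assoc, ← mul_smul_comm, ← h, ← mul_assoc, inv, one_mul]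

theorem map_pow_sub_one_mul_of_leibniz {B : Type*} [CommRing B] (D : B →+ B)
    (hD : ∀ F G, D (F * G) = F * D G + G * D F) (k : ℕ) {u v W : B} (hvW : v * W = 1)
    (hu : D u = W * (1 + u)) (hv : D v = -(k : B)) : D (v * ((1 + u) ^ k - 1)) = k := by
  have h1 : D 1 = 0 := by simpa using hD 1 1
  have hpow (n : ℕ) : D ((1 + u) ^ n) = n * W * (1 + u) ^ n := by
    induction n with
    | zero => simp [h1]
    | succ n ih => rw [pow_succ, hD, ih, map_add, h1, hu]; push_cast; ring
  rw [hD, map_sub, hpow, h1, hv]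
  linear_combination (k : B) * (1 + u) ^ k * hvW

theorem aSeries_eq (k : ℕ) :
    aSeries k = HahnSeries.single (-(k : ℤ)) 1 * ((1 + HahnSeries.single 1 (T 1)) ^ k - 1) := by
  rw [add_comm (1 : LaurentSeries ℂ[T;T⁻¹]), add_pow, Finset.sum_range_succ']
  simp only [pow_zero, one_pow, mul_one, Nat.choose_zero_right, Nat.cast_one, add_sub_cancel_right]
  rw [aSeries, Finset.range_eq_Ico, Finset.sum_Ico_add' (fun l =>
    (HahnSeries.single 1 (T 1) : LaurentSeries ℂ[T;T⁻¹]) ^ l *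
      (k.choose l : LaurentSeries ℂ[T;T⁻¹])), zero_add, Finset.mul_sum]
  refine Finset.sum_congr (by ext; simp) fun l _ => ?_
  rw [← HahnSeries.single_zero_natCast, HahnSeries.single_pow, T_pow, HahnSeries.single_mul_single,
    HahnSeries.single_mul_single, Nat.cast_smul_eq_nsmul, nsmul_eq_mul]
  simp only [nsmul_eq_mul, mul_one, one_mul, add_zero, neg_add_eq_sub]
  rw [mul_comm]

/-- `w ∂/∂w` multiplies the coefficient in degree `m` by `m`. -/
theorem single_one_mul_derivW (F : LaurentSeries ℂ[T;T⁻¹]) :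
    HahnSeries.single 1 1 * derivW F
      = HahnSeries.coeffwise (fun m : ℤ => zsmulAddGroupHom m) F := by
  ext m : 2
  have h := HahnSeries.coeff_single_mul_add (r := (1 : ℂ[T;T⁻¹])) (x := derivW F) (a := m - 1)
    (b := (1 : ℤ))
  rw [sub_add_cancel, one_mul] at h
  rw [h]
  simp [derivW]

/-- The operator `w^{k-1} ∂/∂x + w^{k+1} ∂/∂w`. -/
noncomputable def weightedDerivation (k : ℕ) (Dx : ℂ[T;T⁻¹] →ₗ[ℂ] ℂ[T;T⁻¹]) :
    LaurentSeries ℂ[T;T⁻¹] →+ LaurentSeries ℂ[T;T⁻¹] :=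
  (AddMonoidHom.mulLeft (HahnSeries.single ((k : ℤ) - 1) 1)).comp
      (HahnSeries.coeffwise fun _ => Dx.toAddMonoidHom)
    + (AddMonoidHom.mulLeft (HahnSeries.single (k : ℤ) 1)).comp
      (HahnSeries.coeffwise fun m : ℤ => zsmulAddGroupHom m)

theorem weightedDerivation_apply (k : ℕ) (Dx : ℂ[T;T⁻¹] →ₗ[ℂ] ℂ[T;T⁻¹])
    (F : LaurentSeries ℂ[T;T⁻¹]) :
    weightedDerivation k Dx F = HahnSeries.single ((k : ℤ) - 1) 1 * derivX Dx F
      + HahnSeries.single ((k : ℤ) + 1) 1 * derivW F := by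
  rw [← one_mul (1 : ℂ[T;T⁻¹]), ← HahnSeries.single_mul_single (a := (k : ℤ)), mul_assoc,
    single_one_mul_derivW, one_mul]
  rfl

theorem weightedDerivation_mul (k : ℕ) (Dx : ℂ[T;T⁻¹] →ₗ[ℂ] ℂ[T;T⁻¹])
    (hDx : ∀ n : ℤ, Dx (T n) = n • T (n - 1)) (F G : LaurentSeries ℂ[T;T⁻¹]) :
    weightedDerivation k Dx (F * G)
      = F * weightedDerivation k Dx G + G * weightedDerivation k Dx F := by
  have hX := HahnSeries.coeffwise_mul (fun _ : ℤ => Dx.toAddMonoidHom)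
    (fun _ _ => leibniz_of_map_T Dx hDx) F G
  have hW := HahnSeries.coeffwise_mul (fun m : ℤ => zsmulAddGroupHom (α := ℂ[T;T⁻¹]) m)
    (fun m n a b => by
      change (m + n) • (a * b) = a * (n • b) + b * (m • a)
      rw [mul_smul_comm, mul_smul_comm, mul_comm b a, add_smul, add_comm]) F G
  simp only [weightedDerivation, AddMonoidHom.add_apply, AddMonoidHom.comp_apply,
    AddMonoidHom.coe_mulLeft, hX, hW]
  ring

theorem weightedDerivation_single (k : ℕ) (Dx : ℂ[T;T⁻¹] →ₗ[ℂ] ℂ[T;T⁻¹]) (m : ℤ)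
    (a : ℂ[T;T⁻¹]) : weightedDerivation k Dx (HahnSeries.single m a)
      = HahnSeries.single (k - 1 + m) (Dx a) + HahnSeries.single (k + m) (m • a) := by
  simp only [weightedDerivation, AddMonoidHom.add_apply, AddMonoidHom.comp_apply,
    AddMonoidHom.coe_mulLeft, HahnSeries.coeffwise_single, HahnSeries.single_mul_single, one_mul]
  rfl

theorem weightedDerivation_aSeries (k : ℕ) (Dx : ℂ[T;T⁻¹] →ₗ[ℂ] ℂ[T;T⁻¹])
    (hDx : ∀ n : ℤ, Dx (T n) = n • T (n - 1)) :
    weightedDerivation k Dx (aSeries k) = k := by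
  have hone : Dx 1 = 0 := by rw [← T_zero, hDx, zero_smul]
  rw [aSeries_eq]
  refine map_pow_sub_one_mul_of_leibniz _ (weightedDerivation_mul k Dx hDx) k
    (W := HahnSeries.single (k : ℤ) 1) ?_ ?_ ?_
  · rw [HahnSeries.single_mul_single, neg_add_cancel, one_mul, HahnSeries.single_zero_one]
  · rw [weightedDerivation_single, hDx, mul_add, HahnSeries.single_mul_single]
    simp
  · rw [weightedDerivation_single, hone, HahnSeries.single_eq_zero, zero_add, add_neg_cancel,
      neg_smul, HahnSeries.single_neg, natCast_zsmul, nsmul_one, HahnSeries.single_zero_natCast]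

theorem weightedDerivation_C_C (k : ℕ) (Dx : ℂ[T;T⁻¹] →ₗ[ℂ] ℂ[T;T⁻¹])
    (hDx : ∀ n : ℤ, Dx (T n) = n • T (n - 1)) (r : ℂ) :
    weightedDerivation k Dx (HahnSeries.C (C r)) = 0 := by
  have hr : Dx (C r) = 0 := by
    rw [← mul_one (C r), ← T_zero, ← smul_eq_C_mul, map_smul, hDx, zero_smul, smul_zero]
  rw [HahnSeries.C_apply, weightedDerivation_single, hr]
  simp

theorem natCast_mul_map_eq_weightedDerivation (k : ℕ) (Dx : ℂ[T;T⁻¹] →ₗ[ℂ] ℂ[T;T⁻¹])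
    (hDx : ∀ n : ℤ, Dx (T n) = n • T (n - 1)) (A : ℂ[T;T⁻¹] →+* LaurentSeries ℂ[T;T⁻¹])
    (hC : ∀ r : ℂ, A (C r) = HahnSeries.C (C r)) (hA : A (T 1) = aSeries k) (p : ℂ[T;T⁻¹]) :
    (k : LaurentSeries ℂ[T;T⁻¹]) * A (Dx p) = weightedDerivation k Dx (A p) := by
  induction p using LaurentPolynomial.induction_on' with
  | add p q hp hq => rw [map_add, map_add, mul_add, hp, hq, map_add, map_add]
  | C_mul_T n r =>
    have hD := weightedDerivation_mul k Dx hDx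
    rw [← smul_eq_C_mul, map_smul, hDx, smul_eq_C_mul, smul_eq_C_mul, map_mul, map_mul, hC, hD,
      weightedDerivation_C_C k Dx hDx, mul_zero, add_zero, map_ringHom_T_of_leibniz _ hD, hA,
      weightedDerivation_aSeries k Dx hDx, map_zsmul, mul_left_comm, mul_smul_comm,
      mul_comm (A _)]

theorem algebraMap_laurentSeries_eq_C_C (r : ℂ) :
    algebraMap ℂ (LaurentSeries ℂ[T;T⁻¹]) r = HahnSeries.C (C r) := by
  rw [HahnSeries.algebraMap_apply', PowerSeries.algebraMap_apply, HahnSeries.ofPowerSeries_C,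
    LaurentPolynomial.algebraMap_apply, Algebra.algebraMap_self_apply]

/-- For every Laurent polynomial `p`,
`k·A(dp/dx) = w^{k−1}·∂(Ap)/∂x + w^{k+1}·∂(Ap)/∂w`. -/
theorem stmt5 (k : ℕ) (hk : 0 < k)
    (Dx : LaurentPolynomial ℂ →ₗ[ℂ] LaurentPolynomial ℂ)
    (hDx : ∀ n : ℤ, Dx (LaurentPolynomial.T n) = n • LaurentPolynomial.T (n - 1))
    (A : LaurentPolynomial ℂ →ₐ[ℂ] LaurentSeries (LaurentPolynomial ℂ))
    (hA : A (LaurentPolynomial.T 1) = aSeries k)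
    (p : LaurentPolynomial ℂ) :
    (k : LaurentSeries (LaurentPolynomial ℂ)) * A (Dx p)
      = HahnSeries.single ((k : ℤ) - 1) (1 : LaurentPolynomial ℂ) * derivX Dx (A p)
        + HahnSeries.single ((k : ℤ) + 1) (1 : LaurentPolynomial ℂ) * derivW (A p) := by
  rw [← weightedDerivation_apply]
  exact natCast_mul_map_eq_weightedDerivation k Dx hDx A.toRingHom
    (fun r => (A.commutes r).trans (algebraMap_laurentSeries_eq_C_C r)) hA p
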